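/- Consider an instance of Constrained Maximum Coverage given by a finite universe U and k nonempty collections 𝓡₁, …, 𝓡_k of subsets of U. Let R₁, …, R_k be the sets selected by the greedy algorithm (R₁ of maximum cardinality in 𝓡₁ and, for i ≥ 2, R_i ∈ 𝓡_i maximizing |R_i \ (R₁ ∪ ⋯ ∪ R_{i−1})|), and let S₁, …, S_k be any solution with S_i ∈ 𝓡_i. Then |R₁ ∪ ⋯ ∪ R_k| ≥ (1/2)·|S₁ ∪ ⋯ ∪ S_k|; i.e., the greedy algorithm is a 1/2-approximation for Constrained Maximum Coverage. -/

import Mathlib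

/-- The marginal contributions of a sequence of finite sets add up to at most the size of their
union. -/
theorem sum_card_sdiff_sup_Iio_le {α : Type*} [DecidableEq α] {k : ℕ} (R : Fin k → Finset α) :
    ∑ i, (R i \ (Finset.Iio i).sup R).card ≤ (Finset.univ.sup R).card := by
  have hlt : ∀ i j, i < j →
      Disjoint (R i \ (Finset.Iio i).sup R) (R j \ (Finset.Iio j).sup R) := fun i j hij =>
    Finset.disjoint_sdiff.mono_left
      (Finset.sdiff_subset.trans (Finset.le_sup (f := R) (Finset.mem_Iio.2 hij)))
  rw [← Finset.card_biUnion fun i _ j _ hij =>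
    hij.lt_or_gt.elim (hlt i j) fun h => (hlt j i h).symm]
  exact Finset.card_le_card (Finset.biUnion_subset.2 fun i _ =>
    Finset.sdiff_subset.trans (Finset.le_sup (f := R) (Finset.mem_univ i)))

/-- If every `S i` has at most the marginal contribution of `R i` over the earlier `R j`, then the
part of the union of `S` missed by the union of `R` is no larger than the union of `R`. -/
theorem card_sup_sdiff_sup_le {α : Type*} [DecidableEq α] {k : ℕ} {R S : Fin k → Finset α}
    (h : ∀ i, (S i \ (Finset.Iio i).sup R).card ≤ (R i \ (Finset.Iio i).sup R).card) :
    (Finset.univ.sup S \ Finset.univ.sup R).card ≤ (Finset.univ.sup R).card := by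
  have hcover : Finset.univ.sup S \ Finset.univ.sup R ⊆
      Finset.univ.biUnion fun i => S i \ (Finset.Iio i).sup R := by
    have hmono (i : Fin k) : (Finset.Iio i).sup R ⊆ Finset.univ.sup R :=
      Finset.sup_mono (Finset.subset_univ _)
    intro x hx
    obtain ⟨hxS, hxR⟩ := Finset.mem_sdiff.1 hx
    obtain ⟨i, -, hxi⟩ := Finset.mem_sup.1 hxS
    exact Finset.mem_biUnion.2 ⟨i, Finset.mem_univ i, Finset.mem_sdiff.2
      ⟨hxi, fun hx' => hxR (hmono i hx')⟩⟩
  calc (Finset.univ.sup S \ Finset.univ.sup R).card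
      ≤ ∑ i, (S i \ (Finset.Iio i).sup R).card :=
        (Finset.card_le_card hcover).trans Finset.card_biUnion_le
    _ ≤ ∑ i, (R i \ (Finset.Iio i).sup R).card := Finset.sum_le_sum fun i _ => h i
    _ ≤ (Finset.univ.sup R).card := sum_card_sdiff_sup_Iio_le R

/-- the greedy algorithm is a 1/2-approximation for Constrained
Maximum Coverage: `|R₁ ∪ ⋯ ∪ R_k| ≥ (1/2)·|S₁ ∪ ⋯ ∪ S_k|` for any solution `S`. -/
theorem statement3 {α : Type*} [DecidableEq α] (U : Finset α) (k : ℕ)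
    (𝓡 : Fin k → Finset (Finset α)) (hne : ∀ i, (𝓡 i).Nonempty)
    (hsub : ∀ i, ∀ R ∈ 𝓡 i, R ⊆ U)
    (R : Fin k → Finset α) (hRmem : ∀ i, R i ∈ 𝓡 i)
    (hgreedy : ∀ i, ∀ T ∈ 𝓡 i,
      (T \ (Finset.Iio i).sup R).card ≤ (R i \ (Finset.Iio i).sup R).card)
    (S : Fin k → Finset α) (hSmem : ∀ i, S i ∈ 𝓡 i) :
    ((Finset.univ.sup R).card : ℝ) ≥ (1 / 2) * (Finset.univ.sup S).card := by
  have hmissed := card_sup_sdiff_sup_le fun i => hgreedy i (S i) (hSmem i)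
  have hsplit := Finset.card_le_card_sdiff_add_card
    (s := Finset.univ.sup S) (t := Finset.univ.sup R)
  have htwo : ((Finset.univ.sup S).card : ℝ) ≤ 2 * (Finset.univ.sup R).card := by
    exact_mod_cast (by omega : (Finset.univ.sup S).card ≤ 2 * (Finset.univ.sup R).card)
  linarith
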